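/- Fix an integer n ≥ 2, x₀ > 0, and fees 0 ≤ ĉ < c < 1. Let λ(·) = (1 - n·(·) + (n-1)·(·)^{n/(n-1)})/n, x̄(c) = (1-c)x₀/λ(c), and let F̃_c, F̃_ĉ be the driftless equilibrium cdfs F̃_c(x) = (c + λ(c)·x/x₀)^{1/(n-1)} on [0, x̄(c)] (= 1 above), similarly for ĉ. Let φ : [0, x̄(c)] → ℝ be nondecreasing and absolutely continuous. If φ is convex, then ∫ φ dF̃_ĉ ≤ ∫ φ dF̃_c; if φ is concave, then ∫ φ dF̃_ĉ ≥ ∫ φ dF̃_c. The inequalities are strict unless φ is affine. -/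

import Mathlib

open MeasureTheory

/-- The slope coefficient `λ(c) = (1 - n·c + (n-1)·c^{n/(n-1)})/n` of the equilibrium
winning probability in the `n`-player risk-taking contest with submission fee `c`. -/
noncomputable def lamFee (n : ℕ) (c : ℝ) : ℝ :=
  (1 - n * c + ((n : ℝ) - 1) * c ^ ((n : ℝ) / ((n : ℝ) - 1))) / n

/-- Upper bound of the support of the driftless equilibrium distribution:
`x̄(c) = (1-c)·x₀/λ(c)`. -/
noncomputable def tildeXbar (n : ℕ) (x₀ c : ℝ) : ℝ :=
  (1 - c) * x₀ / lamFee n c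

/-- The driftless equilibrium cdf: `F̃_c(x) = (c + λ(c)·x/x₀)^{1/(n-1)}` on `[0, x̄(c)]`,
equal to `1` above `x̄(c)` and `0` below `0`. -/
noncomputable def tildeF (n : ℕ) (x₀ c x : ℝ) : ℝ :=
  if x < 0 then 0
  else if x ≤ tildeXbar n x₀ c then (c + lamFee n c * x / x₀) ^ ((1 : ℝ) / ((n : ℝ) - 1))
  else 1

/-- The quantile function of `tildeF n x₀ c` on `[0, 1]`. -/
noncomputable def tildeQuantile (n : ℕ) (x₀ c u : ℝ) : ℝ :=
  x₀ / lamFee n c * max (u ^ (n - 1) - c) 0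

theorem lamFee_eq_integral {n : ℕ} (hn : 2 ≤ n) {c : ℝ} (hc0 : 0 ≤ c) (hc1 : c < 1) :
    lamFee n c = ∫ u in (0 : ℝ)..1, max (u ^ (n - 1) - c) 0 := by
  obtain ⟨m, rfl⟩ : ∃ m, n = m + 1 := ⟨n - 1, by omega⟩
  have hm : m ≠ 0 := by omega
  have hmR : (m : ℝ) ≠ 0 := by exact_mod_cast hm
  set w : ℝ := c ^ ((m : ℝ)⁻¹) with hw
  have hw0 : 0 ≤ w := by positivity
  have hwm : w ^ m = c := Real.rpow_inv_natCast_pow hc0 hm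
  have hw1 : w ≤ 1 := Real.rpow_le_one hc0 hc1.le (by positivity)
  have hpow : c ^ (((m + 1 : ℕ) : ℝ) / (((m + 1 : ℕ) : ℝ) - 1)) = c * w := by
    have : ((m + 1 : ℕ) : ℝ) / (((m + 1 : ℕ) : ℝ) - 1) = (m : ℝ)⁻¹ * ((m + 1 : ℕ) : ℝ) := by
      rw [Nat.cast_succ, add_sub_cancel_right, div_eq_inv_mul]
    rw [this, Real.rpow_mul hc0, Real.rpow_natCast, pow_succ, hwm]
  have hcont : Continuous fun u : ℝ => max (u ^ m - c) 0 := by fun_prop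
  have hsplit := intervalIntegral.integral_add_adjacent_intervals
    (hcont.intervalIntegrable (μ := volume) 0 w) (hcont.intervalIntegrable (μ := volume) w 1)
  have hlow : (∫ u in (0 : ℝ)..w, max (u ^ m - c) 0) = ∫ _u in (0 : ℝ)..w, (0 : ℝ) := by
    refine intervalIntegral.integral_congr fun u hu => ?_
    rw [Set.uIcc_of_le hw0] at hu
    have := pow_le_pow_left₀ hu.1 hu.2 m
    exact max_eq_right (by linarith)
  have hhigh : (∫ u in w..(1 : ℝ), max (u ^ m - c) 0) = ∫ u in w..(1 : ℝ), (u ^ m - c) := by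
    refine intervalIntegral.integral_congr fun u hu => ?_
    rw [Set.uIcc_of_le hw1] at hu
    have := pow_le_pow_left₀ hw0 hu.1 m
    exact max_eq_left (by linarith)
  have hw' : w ^ (m + 1) = c * w := by rw [pow_succ, hwm]
  simp only [Nat.add_sub_cancel]
  rw [← hsplit, hlow, hhigh, intervalIntegral.integral_sub (by simp) (by simp), integral_pow,
    lamFee, hpow, hw']
  simp only [intervalIntegral.integral_const, smul_eq_mul]
  push_cast
  field_simp
  ring

theorem lamFee_pos {n : ℕ} (hn : 2 ≤ n) {c : ℝ} (hc0 : 0 ≤ c) (hc1 : c < 1) :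
    0 < lamFee n c := by
  rw [lamFee_eq_integral hn hc0 hc1]
  refine intervalIntegral.integral_pos zero_lt_one (by fun_prop) (fun u _ => le_max_right _ _)
    ⟨1, by simp, by simp [hc1]⟩

theorem lamFee_lt_lamFee {n : ℕ} (hn : 2 ≤ n) {c c' : ℝ} (hc' : 0 ≤ c') (hcc : c' < c)
    (hc : c < 1) : lamFee n c < lamFee n c' := by
  rw [lamFee_eq_integral hn hc' (hcc.trans hc), lamFee_eq_integral hn (hc'.trans hcc.le) hc]
  refine intervalIntegral.integral_lt_integral_of_continuousOn_of_le_of_exists_lt zero_lt_one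
    (by fun_prop) (by fun_prop) (fun u _ => max_le_max (by linarith) le_rfl) ⟨1, by simp, ?_⟩
  simp only [one_pow]
  rw [max_eq_left (by linarith), max_eq_left (by linarith)]
  linarith

theorem continuous_tildeQuantile (n : ℕ) (x₀ c : ℝ) : Continuous (tildeQuantile n x₀ c) := by
  unfold tildeQuantile
  fun_prop

theorem integral_tildeQuantile {n : ℕ} (hn : 2 ≤ n) {x₀ c : ℝ} (hc0 : 0 ≤ c) (hc1 : c < 1) :
    ∫ u in (0 : ℝ)..1, tildeQuantile n x₀ c u = x₀ := by
  unfold tildeQuantile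
  rw [intervalIntegral.integral_const_mul, ← lamFee_eq_integral hn hc0 hc1]
  exact div_mul_cancel₀ _ (lamFee_pos hn hc0 hc1).ne'

theorem tildeXbar_eq (n : ℕ) (x₀ c : ℝ) : tildeXbar n x₀ c = x₀ / lamFee n c * (1 - c) := by
  rw [tildeXbar]
  ring

theorem tildeQuantile_mem {n : ℕ} (hn : 2 ≤ n) {x₀ : ℝ} (hx₀ : 0 < x₀) {c : ℝ} (hc0 : 0 ≤ c)
    (hc1 : c < 1) {u : ℝ} (hu : u ∈ Set.Icc (0 : ℝ) 1) :
    tildeQuantile n x₀ c u ∈ Set.Icc 0 (tildeXbar n x₀ c) := by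
  have hA := div_pos hx₀ (lamFee_pos hn hc0 hc1)
  rw [tildeXbar_eq, tildeQuantile]
  have := pow_le_one₀ hu.1 hu.2 (n := n - 1)
  exact ⟨mul_nonneg hA.le (le_max_right _ _),
    mul_le_mul_of_nonneg_left (max_le (by linarith) (by linarith)) hA.le⟩

theorem tildeQuantile_le_iff {n : ℕ} (hn : 2 ≤ n) {x₀ : ℝ} (hx₀ : 0 < x₀) {c : ℝ} (hc0 : 0 ≤ c)
    (hc1 : c < 1) {u x : ℝ} (hu : 0 ≤ u) (hx : 0 ≤ x) :
    tildeQuantile n x₀ c u ≤ x ↔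
      u ≤ (c + lamFee n c * x / x₀) ^ ((1 : ℝ) / ((n : ℝ) - 1)) := by
  obtain ⟨m, rfl⟩ : ∃ m, n = m + 1 := ⟨n - 1, by omega⟩
  have hm : m ≠ 0 := by omega
  have hlam := lamFee_pos hn hc0 hc1
  have hnn : 0 ≤ lamFee (m + 1) c * x / x₀ := by positivity
  have hexp : (1 : ℝ) / (((m + 1 : ℕ) : ℝ) - 1) = (m : ℝ)⁻¹ := by simp
  rw [hexp, Real.le_rpow_inv_iff_of_pos hu (by positivity) (by positivity), Real.rpow_natCast,
    tildeQuantile, Nat.add_sub_cancel]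
  have hiff : x₀ / lamFee (m + 1) c * max (u ^ m - c) 0 ≤ x ↔
      max (u ^ m - c) 0 ≤ lamFee (m + 1) c * x / x₀ := by
    rw [le_div_iff₀ hx₀, div_mul_eq_mul_div, div_le_iff₀ hlam, mul_comm x₀, mul_comm x]
  rw [hiff, max_le_iff, and_iff_left hnn, sub_le_iff_le_add']

theorem map_tildeQuantile_eq {n : ℕ} (hn : 2 ≤ n) {x₀ : ℝ} (hx₀ : 0 < x₀) {c : ℝ} (hc0 : 0 ≤ c)
    (hc1 : c < 1) {ν : Measure ℝ} [IsProbabilityMeasure ν]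
    (hν : ∀ x : ℝ, ν (Set.Iic x) = ENNReal.ofReal (tildeF n x₀ c x)) :
    (volume.restrict (Set.Icc (0 : ℝ) 1)).map (tildeQuantile n x₀ c) = ν := by
  refine (Measure.ext_of_Iic _ _ fun x => ?_).symm
  have hmeas := (continuous_tildeQuantile n x₀ c).measurable
  rw [hν, Measure.map_apply hmeas measurableSet_Iic,
    Measure.restrict_apply (hmeas measurableSet_Iic), tildeF]
  split_ifs with h0 h1
  · rw [ENNReal.ofReal_zero, eq_comm]
    convert measure_empty (μ := (volume : Measure ℝ))
    ext u
    simp only [Set.mem_inter_iff, Set.mem_preimage, Set.mem_Iic, Set.mem_empty_iff_false,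
      iff_false, not_and]
    intro hu hu'
    linarith [(tildeQuantile_mem hn hx₀ hc0 hc1 hu').1]
  · have hx := not_lt.1 h0
    have hlam := lamFee_pos hn hc0 hc1
    have hn1 : (0 : ℝ) ≤ 1 / ((n : ℝ) - 1) := by
      have : (2 : ℝ) ≤ n := by exact_mod_cast hn
      exact div_nonneg zero_le_one (by linarith)
    set w := (c + lamFee n c * x / x₀) ^ ((1 : ℝ) / ((n : ℝ) - 1)) with hw
    have hle : lamFee n c * x / x₀ ≤ 1 - c := by
      rw [tildeXbar, le_div_iff₀ hlam] at h1
      rw [div_le_iff₀ hx₀]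
      linarith
    have hw1 : w ≤ 1 := Real.rpow_le_one (by positivity) (by linarith) hn1
    have hset : tildeQuantile n x₀ c ⁻¹' Set.Iic x ∩ Set.Icc 0 1 = Set.Icc 0 w := by
      ext u
      simp only [Set.mem_inter_iff, Set.mem_preimage, Set.mem_Iic, Set.mem_Icc]
      constructor
      · rintro ⟨h, hu, -⟩
        exact ⟨hu, (tildeQuantile_le_iff hn hx₀ hc0 hc1 hu hx).1 h⟩
      · rintro ⟨hu, h⟩
        exact ⟨(tildeQuantile_le_iff hn hx₀ hc0 hc1 hu hx).2 h, hu, h.trans hw1⟩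
    rw [hset, Real.volume_Icc, sub_zero]
  · have hset : tildeQuantile n x₀ c ⁻¹' Set.Iic x ∩ Set.Icc 0 1 = Set.Icc 0 1 :=
      Set.inter_eq_right.2 fun u hu =>
        (tildeQuantile_mem hn hx₀ hc0 hc1 hu).2.trans (not_le.1 h1).le
    rw [hset, Real.volume_Icc, sub_zero]

theorem integral_eq_integral_tildeQuantile {n : ℕ} (hn : 2 ≤ n) {x₀ : ℝ} (hx₀ : 0 < x₀) {c : ℝ}
    (hc0 : 0 ≤ c) (hc1 : c < 1) {ν : Measure ℝ} [IsProbabilityMeasure ν]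
    (hν : ∀ x : ℝ, ν (Set.Iic x) = ENNReal.ofReal (tildeF n x₀ c x)) {φ : ℝ → ℝ}
    (hφ : ContinuousOn φ (Set.Icc 0 (tildeXbar n x₀ c))) :
    ∫ x, φ x ∂ν = ∫ u in (0 : ℝ)..1, φ (tildeQuantile n x₀ c u) := by
  have hmap := map_tildeQuantile_eq hn hx₀ hc0 hc1 hν
  have hQ := (continuous_tildeQuantile n x₀ c).aemeasurable
    (μ := volume.restrict (Set.Icc (0 : ℝ) 1))
  have hsupp : ∀ᵐ x ∂ν, x ∈ Set.Icc 0 (tildeXbar n x₀ c) := by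
    rw [← hmap]
    refine (ae_map_iff hQ measurableSet_Icc).2 ?_
    exact (ae_restrict_mem measurableSet_Icc).mono fun u hu => tildeQuantile_mem hn hx₀ hc0 hc1 hu
  have hφm : AEStronglyMeasurable φ ν := by
    rw [← Measure.restrict_eq_self_of_ae_mem hsupp]
    exact hφ.aestronglyMeasurable measurableSet_Icc
  rw [← hmap] at hφm ⊢
  rw [integral_map hQ hφm, integral_Icc_eq_integral_Ioc,
    intervalIntegral.integral_of_le zero_le_one]

theorem ConvexOn.exists_supporting_slope {φ : ℝ → ℝ} {X y : ℝ}
    (hφ : ConvexOn ℝ (Set.Icc 0 X) φ) (hy : y ∈ Set.Ioo 0 X) :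
    ∃ k : ℝ, (∀ a b, 0 ≤ a → a ≤ b → b ≤ y → φ b - φ a ≤ k * (b - a)) ∧
      ∀ a b, y ≤ a → a ≤ b → b ≤ X → k * (b - a) ≤ φ b - φ a := by
  obtain ⟨hy0, hyX⟩ := hy
  obtain ⟨k, hk1, hk2⟩ := exists_between_of_forall_le
    (s := (fun a => (φ y - φ a) / (y - a)) '' Set.Ico 0 y)
    (t := (fun b => (φ b - φ y) / (b - y)) '' Set.Ioc y X)
    ((Set.nonempty_Ico.2 hy0).image _) ((Set.nonempty_Ioc.2 hyX).image _) (by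
      rintro _ ⟨a, ha, rfl⟩ _ ⟨b, hb, rfl⟩
      exact hφ.slope_mono_adjacent ⟨ha.1, by linarith [ha.2]⟩ ⟨by linarith [hb.1], hb.2⟩ ha.2 hb.1)
  refine ⟨k, fun a b ha hab hby => ?_, fun a b hya hab hbX => ?_⟩
  · rcases hab.eq_or_lt with rfl | hab
    · simp
    rw [← div_le_iff₀ (sub_pos.2 hab)]
    rcases hby.eq_or_lt with rfl | hby
    · exact hk1 (Set.mem_image_of_mem _ ⟨ha, hab⟩)
    · exact (hφ.slope_mono_adjacent ⟨ha, by linarith⟩ ⟨by linarith, hyX.le⟩ hab hby).trans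
        (hk1 (Set.mem_image_of_mem _ ⟨by linarith, hby⟩))
  · rcases hab.eq_or_lt with rfl | hab
    · simp
    rw [← le_div_iff₀ (sub_pos.2 hab)]
    rcases hya.eq_or_lt with rfl | hya
    · exact hk2 (Set.mem_image_of_mem _ ⟨hab, hbX⟩)
    · exact (hk2 (Set.mem_image_of_mem _ ⟨hya, by linarith⟩)).trans
        (hφ.slope_mono_adjacent ⟨by linarith, by linarith⟩ ⟨by linarith, hbX⟩ hya hab)

theorem ConvexOn.affine_of_slope_eq {φ : ℝ → ℝ} {X y z k : ℝ}
    (hφ : ConvexOn ℝ (Set.Icc 0 X) φ) (hy : 0 < y) (hz : 0 < z) (hzX : z < X)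
    (hk : ∀ a b, 0 ≤ a → a ≤ b → b ≤ y → φ b - φ a ≤ k * (b - a))
    (hlow : φ y - φ 0 = k * y) (hhigh : φ X - φ z = k * (X - z)) :
    ∀ x ∈ Set.Icc 0 X, φ x = k * x + φ 0 := by
  have hX : 0 < X := hz.trans hzX
  have h0 : (0 : ℝ) ∈ Set.Icc 0 X := ⟨le_rfl, hX.le⟩
  have hXm : X ∈ Set.Icc 0 X := ⟨hX.le, le_rfl⟩
  have hXle : φ X ≤ φ 0 + k * X := by
    have := hφ.slope_mono_adjacent h0 hXm hz hzX
    rw [hhigh, mul_div_cancel_right₀ _ (sub_pos.2 hzX).ne', sub_zero, div_le_iff₀ hz] at this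
    linarith
  rintro x ⟨hx0, hxX⟩
  refine le_antisymm ?_ ?_
  · have h := hφ.2 h0 hXm (sub_nonneg.2 ((div_le_one hX).2 hxX))
      (div_nonneg hx0 hX.le) (sub_add_cancel _ _)
    have hx : (1 - x / X) • (0 : ℝ) + (x / X) • X = x := by
      simp [hX.ne']
    rw [hx, smul_eq_mul, smul_eq_mul] at h
    have h2 : x / X * φ X ≤ x / X * (φ 0 + k * X) := by gcongr
    have h3 : x / X * (φ 0 + k * X) = x / X * φ 0 + k * x := by field_simp
    linarith
  · rcases le_or_gt x y with hxy | hxy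
    · linarith [hk x y hx0 hxy le_rfl]
    · have := hφ.slope_mono_adjacent h0 ⟨hx0, hxX⟩ hy hxy
      rw [hlow, sub_zero, mul_div_cancel_right₀ _ hy.ne', le_div_iff₀ (sub_pos.2 hxy)] at this
      linarith

/-- Two hinge functions of different slopes are ordered before and after their crossing point. -/
theorem hinge_crossing {A B c c' : ℝ} (hB : 0 < B) (hBA : B < A) (hcc : c' < c)
    (t : ℝ) :
    (A * max (t - c) 0 ≤ B * max (t - c') 0 ∧
        B * max (t - c') 0 ≤ A * B * (c - c') / (A - B)) ∨
      (A * B * (c - c') / (A - B) ≤ B * max (t - c') 0 ∧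
        B * max (t - c') 0 ≤ A * max (t - c) 0) := by
  have hAB : 0 < A - B := sub_pos.2 hBA
  have hA : 0 < A := hB.trans hBA
  have hcc' : 0 < c - c' := sub_pos.2 hcc
  rw [le_div_iff₀ hAB, div_le_iff₀ hAB]
  rcases le_or_gt t c with h | h
  · left
    rw [max_eq_right (by linarith : t - c ≤ 0), mul_zero]
    refine ⟨mul_nonneg hB.le (le_max_right _ _), ?_⟩
    have h1 : max (t - c') 0 ≤ c - c' := max_le (by linarith) hcc'.le
    calc B * max (t - c') 0 * (A - B) ≤ B * (c - c') * (A - B) := by gcongr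
      _ ≤ A * B * (c - c') := by nlinarith [mul_pos (mul_pos hB hB) hcc']
  · rw [max_eq_left (by linarith : 0 ≤ t - c), max_eq_left (by linarith : 0 ≤ t - c')]
    rcases le_total (A * (t - c)) (B * (t - c')) with h1 | h1
    · exact Or.inl ⟨h1, by nlinarith [mul_le_mul_of_nonneg_left h1 hB.le]⟩
    · exact Or.inr ⟨by nlinarith [mul_le_mul_of_nonneg_left h1 hB.le], h1⟩

theorem tildeXbar_lt_tildeXbar {n : ℕ} (hn : 2 ≤ n) {x₀ : ℝ} (hx₀ : 0 < x₀) {c c' : ℝ}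
    (hc' : 0 ≤ c') (hcc : c' < c) (hc : c < 1) : tildeXbar n x₀ c' < tildeXbar n x₀ c := by
  have hc0 : 0 ≤ c := hc'.trans hcc.le
  have hc'1 : c' < 1 := hcc.trans hc
  have hlam := lamFee_pos hn hc0 hc
  have hlt := lamFee_lt_lamFee hn hc' hcc hc
  have hB : 0 < x₀ / lamFee n c' := div_pos hx₀ (hlam.trans hlt)
  have hBA : x₀ / lamFee n c' < x₀ / lamFee n c := div_lt_div_of_pos_left hx₀ hlam hlt
  by_contra! hle
  rw [tildeXbar_eq, tildeXbar_eq] at hle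
  have hpt : ∀ u ∈ Set.Icc (0 : ℝ) 1, tildeQuantile n x₀ c u ≤ tildeQuantile n x₀ c' u := by
    intro u hu
    have hu1 := pow_le_one₀ hu.1 hu.2 (n := n - 1)
    unfold tildeQuantile
    rcases le_or_gt (u ^ (n - 1)) c with h | h
    · rw [max_eq_right (by linarith : u ^ (n - 1) - c ≤ 0), mul_zero]
      exact mul_nonneg hB.le (le_max_right _ _)
    · rw [max_eq_left (by linarith : 0 ≤ u ^ (n - 1) - c),
        max_eq_left (by linarith : 0 ≤ u ^ (n - 1) - c')]
      nlinarith
  have hlt' := intervalIntegral.integral_lt_integral_of_continuousOn_of_le_of_exists_lt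
    zero_lt_one (continuous_tildeQuantile n x₀ c).continuousOn
    (continuous_tildeQuantile n x₀ c').continuousOn
    (fun u hu => hpt u ⟨hu.1.le, hu.2⟩)
    (by
      obtain ⟨u, hu, huc⟩ : c ∈ (fun u : ℝ => u ^ (n - 1)) '' Set.Icc 0 1 :=
        intermediate_value_Icc zero_le_one (by fun_prop)
          ⟨by simpa [zero_pow (by omega : n - 1 ≠ 0)] using hc0, by simpa using hc.le⟩
      refine ⟨u, hu, ?_⟩
      simp only at huc
      simp only [tildeQuantile, huc, sub_self, max_self, mul_zero]
      exact mul_pos hB (lt_max_of_lt_left (by linarith)))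
  rw [integral_tildeQuantile hn hc0 hc, integral_tildeQuantile hn hc' hc'1] at hlt'
  exact lt_irrefl _ hlt'

theorem tildeQuantile_convex_comparison {n : ℕ} (hn : 2 ≤ n) {x₀ : ℝ} (hx₀ : 0 < x₀) {c c' : ℝ}
    (hc' : 0 ≤ c') (hcc : c' < c) (hc : c < 1) {φ : ℝ → ℝ}
    (hφc : ContinuousOn φ (Set.Icc 0 (tildeXbar n x₀ c)))
    (hφ : ConvexOn ℝ (Set.Icc 0 (tildeXbar n x₀ c)) φ) :
    (∫ u in (0 : ℝ)..1, φ (tildeQuantile n x₀ c' u)) ≤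
        (∫ u in (0 : ℝ)..1, φ (tildeQuantile n x₀ c u)) ∧
      ((¬ ∃ a b : ℝ, ∀ x ∈ Set.Icc (0 : ℝ) (tildeXbar n x₀ c), φ x = a * x + b) →
        (∫ u in (0 : ℝ)..1, φ (tildeQuantile n x₀ c' u)) <
          ∫ u in (0 : ℝ)..1, φ (tildeQuantile n x₀ c u)) := by
  have hc0 : 0 ≤ c := hc'.trans hcc.le
  have hc'1 : c' < 1 := hcc.trans hc
  have hlam := lamFee_pos hn hc0 hc
  have hlt := lamFee_lt_lamFee hn hc' hcc hc
  have hX := tildeXbar_lt_tildeXbar hn hx₀ hc' hcc hc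
  set A := x₀ / lamFee n c with hAdef
  set B := x₀ / lamFee n c' with hBdef
  have hB : 0 < B := div_pos hx₀ (hlam.trans hlt)
  have hBA : B < A := div_lt_div_of_pos_left hx₀ hlam hlt
  have hAB : 0 < A - B := sub_pos.2 hBA
  have hA : 0 < A := hB.trans hBA
  have hcc' : 0 < c - c' := sub_pos.2 hcc
  set y := A * B * (c - c') / (A - B) with hy
  have hy0 : 0 < y := by positivity
  have hXc : tildeXbar n x₀ c = A * (1 - c) := tildeXbar_eq n x₀ c
  have hXc' : tildeXbar n x₀ c' = B * (1 - c') := tildeXbar_eq n x₀ c'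
  have hX'pos : 0 < tildeXbar n x₀ c' := by
    rw [hXc']
    exact mul_pos hB (by linarith)
  have hyX : y < tildeXbar n x₀ c := by
    rw [hXc, hXc'] at hX
    rw [hXc, hy, div_lt_iff₀ hAB]
    nlinarith [mul_lt_mul_of_pos_left hX hA]
  obtain ⟨k, hk1, hk2⟩ := hφ.exists_supporting_slope ⟨hy0, hyX⟩
  have hQ : ∀ u ∈ Set.Icc (0 : ℝ) 1, tildeQuantile n x₀ c u ∈ Set.Icc 0 (tildeXbar n x₀ c) :=
    fun u hu => tildeQuantile_mem hn hx₀ hc0 hc hu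
  have hQ' : ∀ u ∈ Set.Icc (0 : ℝ) 1, tildeQuantile n x₀ c' u ∈ Set.Icc 0 (tildeXbar n x₀ c) :=
    fun u hu => Set.Icc_subset_Icc_right hX.le (tildeQuantile_mem hn hx₀ hc' hc'1 hu)
  have hpt : ∀ u ∈ Set.Icc (0 : ℝ) 1,
      φ (tildeQuantile n x₀ c' u) - k * tildeQuantile n x₀ c' u ≤
        φ (tildeQuantile n x₀ c u) - k * tildeQuantile n x₀ c u := by
    intro u hu
    rcases hinge_crossing hB hBA hcc (u ^ (n - 1)) with ⟨h1, h2⟩ | ⟨h1, h2⟩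
    · linarith [hk1 (tildeQuantile n x₀ c u) (tildeQuantile n x₀ c' u) (hQ u hu).1 h1 h2]
    · linarith [hk2 (tildeQuantile n x₀ c' u) (tildeQuantile n x₀ c u) h1 h2 (hQ u hu).2]
  have hcq := (continuous_tildeQuantile n x₀ c).continuousOn (s := Set.Icc (0 : ℝ) 1)
  have hcq' := (continuous_tildeQuantile n x₀ c').continuousOn (s := Set.Icc (0 : ℝ) 1)
  have hcφ : ContinuousOn (fun u => φ (tildeQuantile n x₀ c u)) (Set.Icc 0 1) :=
    hφc.comp hcq hQ
  have hcφ' : ContinuousOn (fun u => φ (tildeQuantile n x₀ c' u)) (Set.Icc 0 1) :=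
    hφc.comp hcq' hQ'
  have hcont : ContinuousOn (fun u => φ (tildeQuantile n x₀ c u) -
      k * tildeQuantile n x₀ c u) (Set.Icc 0 1) :=
    hcφ.sub (hcq.const_mul k)
  have hcont' : ContinuousOn (fun u => φ (tildeQuantile n x₀ c' u) -
      k * tildeQuantile n x₀ c' u) (Set.Icc 0 1) :=
    hcφ'.sub (hcq'.const_mul k)
  have hii : ∀ {f : ℝ → ℝ}, ContinuousOn f (Set.Icc 0 1) → IntervalIntegrable f volume 0 1 :=
    fun hf => hf.intervalIntegrable_of_Icc zero_le_one
  have hint : (∫ u in (0 : ℝ)..1, (φ (tildeQuantile n x₀ c u) - k * tildeQuantile n x₀ c u)) =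
      (∫ u in (0 : ℝ)..1, φ (tildeQuantile n x₀ c u)) - k * x₀ := by
    rw [intervalIntegral.integral_sub (hii hcφ) (hii (hcq.const_mul k)),
      intervalIntegral.integral_const_mul, integral_tildeQuantile hn hc0 hc]
  have hint' :
      (∫ u in (0 : ℝ)..1, (φ (tildeQuantile n x₀ c' u) - k * tildeQuantile n x₀ c' u)) =
      (∫ u in (0 : ℝ)..1, φ (tildeQuantile n x₀ c' u)) - k * x₀ := by
    rw [intervalIntegral.integral_sub (hii hcφ') (hii (hcq'.const_mul k)),
      intervalIntegral.integral_const_mul, integral_tildeQuantile hn hc' hc'1]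
  refine ⟨?_, fun hna => ?_⟩
  · have := intervalIntegral.integral_mono_on zero_le_one (hii hcont') (hii hcont) hpt
    rw [hint, hint'] at this
    linarith
  · by_contra! hge
    have heq : ∀ u ∈ Set.Icc (0 : ℝ) 1,
        φ (tildeQuantile n x₀ c u) - k * tildeQuantile n x₀ c u =
          φ (tildeQuantile n x₀ c' u) - k * tildeQuantile n x₀ c' u := by
      intro u hu
      refine le_antisymm (not_lt.1 fun hlt => ?_) (hpt u hu)
      have := intervalIntegral.integral_lt_integral_of_continuousOn_of_le_of_exists_lt
        zero_lt_one hcont' hcont (fun v hv => hpt v ⟨hv.1.le, hv.2⟩) ⟨u, hu, hlt⟩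
      rw [hint, hint'] at this
      linarith
    obtain ⟨u, hu, huc⟩ : c ∈ (fun u : ℝ => u ^ (n - 1)) '' Set.Icc 0 1 :=
      intermediate_value_Icc zero_le_one (by fun_prop)
        ⟨by simpa [zero_pow (by omega : n - 1 ≠ 0)] using hc0, by simpa using hc.le⟩
    have hQu : tildeQuantile n x₀ c u = 0 := by
      simp only at huc
      simp [tildeQuantile, huc]
    have hQu' : tildeQuantile n x₀ c' u = B * (c - c') := by
      simp only at huc
      simp [tildeQuantile, huc, hcc'.le, ← hBdef]
    have hQ1 : tildeQuantile n x₀ c 1 = tildeXbar n x₀ c := by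
      simp [tildeQuantile, hc.le, hXc, ← hAdef]
    have hQ1' : tildeQuantile n x₀ c' 1 = tildeXbar n x₀ c' := by
      simp [tildeQuantile, hc'1.le, hXc', ← hBdef]
    have e1 := heq u hu
    have e2 := heq 1 (by simp)
    rw [hQu, hQu'] at e1
    rw [hQ1, hQ1'] at e2
    have hle : B * (c - c') ≤ y := by
      rw [hy, le_div_iff₀ hAB]
      nlinarith [mul_pos (mul_pos hB hB) hcc']
    exact hna ⟨k, φ 0, hφ.affine_of_slope_eq (mul_pos hB hcc') hX'pos hX
      (fun a b ha hab hb => hk1 a b ha hab (hb.trans hle)) (by linarith) (by linarith)⟩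

/-- In the driftless case, for fees `ĉ < c` and a nondecreasing absolutely continuous
`φ`: if `φ` is convex then `∫ φ dF̃_ĉ ≤ ∫ φ dF̃_c`, if `φ` is concave then the reverse
inequality holds, and in each case the inequality is strict unless `φ` is affine.
The integrals are taken against the probability measures `νhat`, `ν` whose cdfs are
`F̃_ĉ`, `F̃_c` respectively. -/
theorem tildeF_convex_comparison (n : ℕ) (hn : 2 ≤ n) (x₀ : ℝ) (hx₀ : 0 < x₀)
    (c c' : ℝ) (hc' : 0 ≤ c') (hc'c : c' < c) (hc : c < 1)
    (ν νhat : Measure ℝ) (hνP : IsProbabilityMeasure ν) (hνhatP : IsProbabilityMeasure νhat)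
    (hν : ∀ x : ℝ, ν (Set.Iic x) = ENNReal.ofReal (tildeF n x₀ c x))
    (hνhat : ∀ x : ℝ, νhat (Set.Iic x) = ENNReal.ofReal (tildeF n x₀ c' x))
    (φ : ℝ → ℝ)
    (hφmono : MonotoneOn φ (Set.Icc 0 (tildeXbar n x₀ c)))
    (hφcont : ContinuousOn φ (Set.Icc 0 (tildeXbar n x₀ c))) :
    (ConvexOn ℝ (Set.Icc 0 (tildeXbar n x₀ c)) φ →
      (∫ x, φ x ∂νhat) ≤ ∫ x, φ x ∂ν) ∧
    (ConcaveOn ℝ (Set.Icc 0 (tildeXbar n x₀ c)) φ →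
      (∫ x, φ x ∂ν) ≤ ∫ x, φ x ∂νhat) ∧
    (ConvexOn ℝ (Set.Icc 0 (tildeXbar n x₀ c)) φ →
      (¬ ∃ a b : ℝ, ∀ x ∈ Set.Icc (0 : ℝ) (tildeXbar n x₀ c), φ x = a * x + b) →
      (∫ x, φ x ∂νhat) < ∫ x, φ x ∂ν) ∧
    (ConcaveOn ℝ (Set.Icc 0 (tildeXbar n x₀ c)) φ →
      (¬ ∃ a b : ℝ, ∀ x ∈ Set.Icc (0 : ℝ) (tildeXbar n x₀ c), φ x = a * x + b) →
      (∫ x, φ x ∂ν) < ∫ x, φ x ∂νhat) := by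
  have hc0 : 0 ≤ c := hc'.trans hc'c.le
  have hsub := Set.Icc_subset_Icc_right (b := (0 : ℝ))
    (tildeXbar_lt_tildeXbar hn hx₀ hc' hc'c hc).le
  rw [integral_eq_integral_tildeQuantile hn hx₀ hc0 hc hν hφcont,
    integral_eq_integral_tildeQuantile hn hx₀ hc' (hc'c.trans hc) hνhat (hφcont.mono hsub)]
  have hneg := fun h : ConcaveOn ℝ (Set.Icc 0 (tildeXbar n x₀ c)) φ =>
    tildeQuantile_convex_comparison hn hx₀ hc' hc'c hc hφcont.neg h.neg
  simp only [Pi.neg_apply, intervalIntegral.integral_neg, neg_le_neg_iff, neg_lt_neg_iff] at hneg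
  refine ⟨fun h => (tildeQuantile_convex_comparison hn hx₀ hc' hc'c hc hφcont h).1,
    fun h => (hneg h).1,
    fun h => (tildeQuantile_convex_comparison hn hx₀ hc' hc'c hc hφcont h).2,
    fun h hna => (hneg h).2 ?_⟩
  rintro ⟨a, b, hab⟩
  exact hna ⟨-a, -b, fun x hx => by linarith [hab x hx]⟩
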